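/- Assume Ω satisfies SR-propagation, all observed values are nonzero, and T ∈ ℝ^⟦N⟧ is the unique rank-one completion. Let β ∈ ⟦N⟧ ∖ Ω and let s(β) = (β^{(0)}, β^{(1)}, …, β^{(m_β)}) be an SR-propagation sequence of β, with α_0 ∈ Ω the element for which {α_0, β^{(0)}; α̃_1, β^{(1)}} is a square in the first propagation step. Then there exist real constants δ_{β^{(0)}}, …, δ_{β^{(m_β)}} with δ_{β^{(0)}} ≠ 0 and a polynomial p̃_β ∈ Σ_{N,2} such that Σ_{i=0}^{m_β} δ_{β^{(i)}}² · (x_{β^{(i)}}² − T_{β^{(i)}}²) = δ_{β^{(0)}}² · (x_β − (T_β/T_{α_0}) x_{α_0})² + p̃_β mod (I_2 + J_2). -/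

import Mathlib

namespace RankOneTC

open scoped BigOperators
open MeasureTheory

/-- The index set `⟦N⟧ = [n 0] × ⋯ × [n (d-1)]`. -/
abbrev Idx {d : ℕ} (n : Fin d → ℕ) : Type := ∀ i : Fin d, Fin (n i)

/-- A tensor is rank one if it is an outer product of `d` vectors. -/
def IsRankOne {d : ℕ} {n : Fin d → ℕ} (T : Idx n → ℝ) : Prop :=
  ∃ u : ∀ i : Fin d, Fin (n i) → ℝ, ∀ α : Idx n, T α = ∏ i : Fin d, u i (α i)

/-- `Ω` satisfies unique recovery: for any nonzero observed values, the rank-one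
completion problem is infeasible or has exactly one solution. -/
def UniqueRecovery {d : ℕ} {n : Fin d → ℕ} (Ω : Set (Idx n)) : Prop :=
  ∀ That : Idx n → ℝ, (∀ α ∈ Ω, That α ≠ 0) →
    {T : Idx n → ℝ | IsRankOne T ∧ ∀ α ∈ Ω, T α = That α}.Subsingleton

/-- The 𝔽₂ vector `v_α`, the concatenation of indicator vectors of the coordinates. -/
def vF2 {d : ℕ} {n : Fin d → ℕ} (α : Idx n) : (Σ i : Fin d, Fin (n i)) → ZMod 2 :=
  fun s => if α s.1 = s.2 then 1 else 0

/-- A generalized square: four distinct tuples whose `v`-vectors sum to zero over 𝔽₂. -/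
def IsGenSquare {d : ℕ} {n : Fin d → ℕ} (α₁ α₂ α₃ α₄ : Idx n) : Prop :=
  [α₁, α₂, α₃, α₄].Nodup ∧ vF2 α₁ + vF2 α₂ + vF2 α₃ + vF2 α₄ = 0

/-- A square `{α₁,α₂;α₃,α₄}`: four distinct tuples with coordinatewise equal max and min
of the two opposite pairs. -/
def IsSquare {d : ℕ} {n : Fin d → ℕ} (α₁ α₂ α₃ α₄ : Idx n) : Prop :=
  [α₁, α₂, α₃, α₄].Nodup ∧
    ∀ k : Fin d, max (α₁ k) (α₂ k) = max (α₃ k) (α₄ k) ∧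
      min (α₁ k) (α₂ k) = min (α₃ k) (α₄ k)

/-- The GS-propagated set `𝒫_GS(Ω)` as an inductive predicate. -/
inductive PGS {d : ℕ} {n : Fin d → ℕ} (Ω : Set (Idx n)) : Idx n → Prop
  | base {α : Idx n} : α ∈ Ω → PGS Ω α
  | prop {α₁ α₂ α₃ β : Idx n} : IsGenSquare α₁ α₂ α₃ β →
      PGS Ω α₁ → PGS Ω α₂ → PGS Ω α₃ → PGS Ω β

def GSPropagation {d : ℕ} {n : Fin d → ℕ} (Ω : Set (Idx n)) : Prop :=
  ∀ β : Idx n, PGS Ω β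

/-- The S-propagated set `𝒫_S(Ω)` as an inductive predicate. -/
inductive PS {d : ℕ} {n : Fin d → ℕ} (Ω : Set (Idx n)) : Idx n → Prop
  | base {α : Idx n} : α ∈ Ω → PS Ω α
  | prop {α₁ α₂ α₃ β : Idx n} : IsSquare α₁ α₂ α₃ β →
      PS Ω α₁ → PS Ω α₂ → PS Ω α₃ → PS Ω β

def SPropagation {d : ℕ} {n : Fin d → ℕ} (Ω : Set (Idx n)) : Prop :=
  ∀ β : Idx n, PS Ω β

/-- The SR-propagated set `𝒫_SR(Ω)` as an inductive predicate. -/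
inductive PSR {d : ℕ} {n : Fin d → ℕ} (Ω : Set (Idx n)) : Idx n → Prop
  | base {α : Idx n} : α ∈ Ω → PSR Ω α
  | prop {α₁ β α₂ γ : Idx n} : IsSquare α₁ β α₂ γ →
      α₁ ∈ Ω → α₂ ∈ Ω → PSR Ω β → PSR Ω γ

def SRPropagation {d : ℕ} {n : Fin d → ℕ} (Ω : Set (Idx n)) : Prop :=
  ∀ β : Idx n, PSR Ω β

/-- A sequence is strongly connected if each later element agrees with some earlier
element in exactly `d - 1` coordinates. -/
def StronglyConnected {d : ℕ} {n : Fin d → ℕ} {p : ℕ} (α : Fin p → Idx n) : Prop :=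
  ∀ k : Fin p, 0 < (k : ℕ) → ∃ i : Fin p, i < k ∧
    (Finset.univ.filter fun j : Fin d => α k j = α i j).card = d - 1

/-- A-propagation: a strongly connected sequence of elements of `Ω` covering all
coordinates. -/
def APropagation {d : ℕ} {n : Fin d → ℕ} (Ω : Set (Idx n)) : Prop :=
  ∃ (p : ℕ) (α : Fin p → Idx n), (∀ k, α k ∈ Ω) ∧ StronglyConnected α ∧
    ∀ (i : Fin d) (j : Fin (n i)), ∃ k : Fin p, α k i = j

/-- The 𝔽₂ matrix `V_Ω` whose rows are the vectors `v_α`, `α ∈ Ω`. -/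
def maskMatrix {d : ℕ} {n : Fin d → ℕ} (Ω : Finset (Idx n)) :
    Matrix {α : Idx n // α ∈ Ω} (Σ i : Fin d, Fin (n i)) (ZMod 2) :=
  Matrix.of fun α s => vF2 α.1 s

/-! ### SDP formulations -/

/-- The bordered matrix `𝐗 = [[1, xᵀ],[x, X]]`, indexed by `Option (Idx n)` where
`none` is the extra index. -/
def border {d : ℕ} {n : Fin d → ℕ} (x : Idx n → ℝ) (X : Matrix (Idx n) (Idx n) ℝ) :
    Matrix (Option (Idx n)) (Option (Idx n)) ℝ :=
  Matrix.of fun a b =>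
    match a, b with
    | Option.none, Option.none => (1 : ℝ)
    | Option.none, Option.some β => x β
    | Option.some α, Option.none => x α
    | Option.some α, Option.some β => X α β

/-- Feasibility for the exact SDP relaxation (SDP-E). -/
structure SDPEFeasible {d : ℕ} {n : Fin d → ℕ} (Ω : Set (Idx n)) (That : Idx n → ℝ)
    (x : Idx n → ℝ) (X : Matrix (Idx n) (Idx n) ℝ) : Prop where
  isSymm : X.IsSymm
  obs : ∀ α ∈ Ω, x α = That α
  obsDiag : ∀ α ∈ Ω, X α α = That α ^ 2
  squares : ∀ α₁ α₂ α₃ α₄ : Idx n, IsSquare α₁ α₂ α₃ α₄ → X α₁ α₂ = X α₃ α₄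
  psd : (border x X).PosSemidef

/-- Tightness of (SDP-E): the matrix `𝐗̄` built from the completion `T` is feasible and
is the unique minimizer of the trace objective. -/
def SDPETight {d : ℕ} {n : Fin d → ℕ} (Ω : Set (Idx n)) (That T : Idx n → ℝ) : Prop :=
  SDPEFeasible Ω That T (Matrix.vecMulVec T T) ∧
  ∀ x X, SDPEFeasible Ω That x X →
    Matrix.trace (Matrix.vecMulVec T T) ≤ Matrix.trace X ∧
    (Matrix.trace X = Matrix.trace (Matrix.vecMulVec T T) →
      x = T ∧ X = Matrix.vecMulVec T T)

/-- Tightness of the weighted relaxation (SDP-Eʷ) with weights `w`. -/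
def SDPEwTight {d : ℕ} {n : Fin d → ℕ} (Ω : Set (Idx n)) (w : Idx n → ℝ)
    (That T : Idx n → ℝ) : Prop :=
  SDPEFeasible Ω That T (Matrix.vecMulVec T T) ∧
  ∀ x X, SDPEFeasible Ω That x X →
    (∑ β : Idx n, w β * Matrix.vecMulVec T T β β) ≤ (∑ β : Idx n, w β * X β β) ∧
    ((∑ β : Idx n, w β * X β β) = (∑ β : Idx n, w β * Matrix.vecMulVec T T β β) →
      x = T ∧ X = Matrix.vecMulVec T T)

/-- Feasibility for the noisy SDP relaxation (SDP-N). -/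
structure SDPNFeasible {d : ℕ} {n : Fin d → ℕ}
    (x : Idx n → ℝ) (X : Matrix (Idx n) (Idx n) ℝ) : Prop where
  isSymm : X.IsSymm
  squares : ∀ α₁ α₂ α₃ α₄ : Idx n, IsSquare α₁ α₂ α₃ α₄ → X α₁ α₂ = X α₃ α₄
  psd : (border x X).PosSemidef

/-- Objective of (SDP-N) with noisy data `Teps` and penalty constant `c`. -/
noncomputable def sdpnObj {d : ℕ} {n : Fin d → ℕ} (Ω : Finset (Idx n))
    (Teps : Idx n → ℝ) (c : ℝ) (x : Idx n → ℝ) (X : Matrix (Idx n) (Idx n) ℝ) : ℝ :=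
  Matrix.trace X + c * ∑ α ∈ Ω, (X α α - 2 * Teps α * x α + Teps α ^ 2)

/-- Optimality for (SDP-N). -/
def SDPNOptimal {d : ℕ} {n : Fin d → ℕ} (Ω : Finset (Idx n)) (Teps : Idx n → ℝ)
    (c : ℝ) (x : Idx n → ℝ) (X : Matrix (Idx n) (Idx n) ℝ) : Prop :=
  SDPNFeasible x X ∧
    ∀ y Y, SDPNFeasible y Y → sdpnObj Ω Teps c x X ≤ sdpnObj Ω Teps c y Y

/-- Frobenius norm of a square real matrix. -/
noncomputable def frob {m : Type*} [Fintype m] (A : Matrix m m ℝ) : ℝ :=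
  Real.sqrt (∑ a : m, ∑ b : m, A a b ^ 2)

/-- `‖ε‖_∞ = max_{α ∈ Ω} |ε α|`. -/
noncomputable def supNormOn {d : ℕ} {n : Fin d → ℕ} (Ω : Finset (Idx n))
    (ε : Idx n → ℝ) : ℝ :=
  ⨆ α : {a : Idx n // a ∈ Ω}, |ε (α : Idx n)|

/-- The function `χ(s) = s + √s`. -/
noncomputable def chiFn (s : ℝ) : ℝ := s + Real.sqrt s

/-! ### Polynomial (sum of squares) machinery -/

/-- `f_α = x_α - T̂_α`. -/
noncomputable def fPoly {d : ℕ} {n : Fin d → ℕ} (That : Idx n → ℝ) (α : Idx n) :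
    MvPolynomial (Idx n) ℝ :=
  MvPolynomial.X α - MvPolynomial.C (That α)

/-- `g_α = x_α² - T̂_α²`. -/
noncomputable def gPoly {d : ℕ} {n : Fin d → ℕ} (That : Idx n → ℝ) (α : Idx n) :
    MvPolynomial (Idx n) ℝ :=
  MvPolynomial.X α ^ 2 - MvPolynomial.C (That α ^ 2)

/-- Sums of squares of polynomials. -/
def IsSOS {d : ℕ} {n : Fin d → ℕ} (p : MvPolynomial (Idx n) ℝ) : Prop :=
  ∃ (k : ℕ) (q : Fin k → MvPolynomial (Idx n) ℝ), p = ∑ i : Fin k, q i ^ 2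

/-- `Σ_{N,2}`: sums of squares of degree at most 2. -/
def SigmaN2 {d : ℕ} {n : Fin d → ℕ} (p : MvPolynomial (Idx n) ℝ) : Prop :=
  IsSOS p ∧ p.totalDegree ≤ 2

/-- The truncated ideal `I₂`, the span of the `f_α` and `g_α` for `α ∈ Ω`. -/
noncomputable def I2span {d : ℕ} {n : Fin d → ℕ} (Ω : Set (Idx n)) (That : Idx n → ℝ) :
    Submodule ℝ (MvPolynomial (Idx n) ℝ) :=
  Submodule.span ℝ
    ({p | ∃ α ∈ Ω, p = fPoly That α} ∪ {p | ∃ α ∈ Ω, p = gPoly That α})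

/-- The truncated ideal `J₂`, the span of the square relations. -/
noncomputable def J2span {d : ℕ} (n : Fin d → ℕ) : Submodule ℝ (MvPolynomial (Idx n) ℝ) :=
  Submodule.span ℝ
    {p | ∃ a b c e : Idx n, IsSquare a b c e ∧
      p = MvPolynomial.X a * MvPolynomial.X b - MvPolynomial.X c * MvPolynomial.X e}

/-- The quadratic polynomial `[1;x]ᵀ Q [1;x]` associated to a matrix `Q ∈ 𝕊^{N+1}`. -/
noncomputable def gramPoly {d : ℕ} {n : Fin d → ℕ}
    (Q : Matrix (Option (Idx n)) (Option (Idx n)) ℝ) : MvPolynomial (Idx n) ℝ :=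
  ∑ a : Option (Idx n), ∑ b : Option (Idx n),
    MvPolynomial.C (Q a b) * (Option.elim a 1 MvPolynomial.X) *
      (Option.elim b 1 MvPolynomial.X)

/-! ### Dual of the noisy SDP -/

/-- The trace inner product `A • B` of two matrices. -/
noncomputable def dotM {m : Type*} [Fintype m] (A B : Matrix m m ℝ) : ℝ :=
  ∑ a : m, ∑ b : m, A a b * B a b

/-- The indicator vector `e_α`, padded with a zero at the extra index. -/
def indVec {d : ℕ} {n : Fin d → ℕ} (α : Idx n) : Option (Idx n) → ℝ :=
  fun o => if o = some α then 1 else 0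

/-- The matrix `A_α = [-T^ε_α; e_α][-T^ε_α; e_α]ᵀ`. -/
noncomputable def Amat {d : ℕ} {n : Fin d → ℕ} (Teps : Idx n → ℝ) (α : Idx n) :
    Matrix (Option (Idx n)) (Option (Idx n)) ℝ :=
  Matrix.vecMulVec (fun o => Option.elim o (-Teps α) (fun β => if β = α then 1 else 0))
    (fun o => Option.elim o (-Teps α) (fun β => if β = α then 1 else 0))

/-- The (padded) matrix `E_{α,β} = e_α e_βᵀ + e_β e_αᵀ`. -/
noncomputable def Ebig {d : ℕ} {n : Fin d → ℕ} (a b : Idx n) :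
    Matrix (Option (Idx n)) (Option (Idx n)) ℝ :=
  Matrix.vecMulVec (indVec a) (indVec b) + Matrix.vecMulVec (indVec b) (indVec a)

/-- The matrix `[[1,0],[0,0]]`. -/
def E00 {d : ℕ} {n : Fin d → ℕ} : Matrix (Option (Idx n)) (Option (Idx n)) ℝ :=
  Matrix.of fun a b => if a = none ∧ b = none then 1 else 0

/-- The matrix `[[0,0],[0,I_N]]`. -/
def Ibot {d : ℕ} {n : Fin d → ℕ} : Matrix (Option (Idx n)) (Option (Idx n)) ℝ :=
  1 - E00

open Classical in
/-- The dual slack matrix of (dSDP-N) associated to data `(ρ, μ)`. -/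
noncomputable def dualNMatrix {d : ℕ} {n : Fin d → ℕ} (Ω : Finset (Idx n))
    (Teps : Idx n → ℝ) (c ρ : ℝ) (μ : Idx n → Idx n → Idx n → Idx n → ℝ) :
    Matrix (Option (Idx n)) (Option (Idx n)) ℝ :=
  Ibot - ρ • E00 + c • (∑ α ∈ Ω, Amat Teps α) -
    ∑ a : Idx n, ∑ b : Idx n, ∑ cc : Idx n, ∑ e : Idx n,
      (if IsSquare a b cc e then (μ a b cc e / 2) • (Ebig a b - Ebig cc e) else 0)

/-- Dual feasibility for (dSDP-N): `Q` is PSD and has the prescribed dual form. -/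
def DualNFeasible {d : ℕ} {n : Fin d → ℕ} (Ω : Finset (Idx n)) (Teps : Idx n → ℝ)
    (c : ℝ) (Q : Matrix (Option (Idx n)) (Option (Idx n)) ℝ) : Prop :=
  Q.PosSemidef ∧ ∃ (ρ : ℝ) (μ : Idx n → Idx n → Idx n → Idx n → ℝ),
    Q = dualNMatrix Ω Teps c ρ μ

/-! ### Level-based weights (Algorithm 1) -/

/-- Cumulative level sets: level 0 is `𝒫_SR(Ω)`; each next level adds the tuples
completing a square with three previously reached tuples. -/
def srLevelSet {d : ℕ} {n : Fin d → ℕ} (Ω : Set (Idx n)) : ℕ → Set (Idx n)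
  | 0 => {β | PSR Ω β}
  | (ℓ + 1) => srLevelSet Ω ℓ ∪ {β | ∃ a b c : Idx n,
      a ∈ srLevelSet Ω ℓ ∧ b ∈ srLevelSet Ω ℓ ∧ c ∈ srLevelSet Ω ℓ ∧ IsSquare a b c β}

/-- The level-based weight vector `w(ϑ)`: `w(ϑ)_β = ϑ^ℓ` where `ℓ` is the first level
containing `β`. -/
noncomputable def levelWeight {d : ℕ} {n : Fin d → ℕ} (Ω : Set (Idx n)) (θ : ℝ)
    (β : Idx n) : ℝ :=
  θ ^ sInf {ℓ : ℕ | β ∈ srLevelSet Ω ℓ}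

/-! ### Random masks -/

/-- The Bernoulli measure on `Bool` with success probability `p`. -/
noncomputable def bern (p : ℝ) : Measure Bool :=
  (ENNReal.ofReal p) • Measure.dirac true + (ENNReal.ofReal (1 - p)) • Measure.dirac false


section

variable {d : ℕ} {n : Fin d → ℕ}

lemma SigmaN2.zero : SigmaN2 (0 : MvPolynomial (Idx n) ℝ) :=
  ⟨⟨0, Fin.elim0, by simp⟩, by simp⟩

lemma SigmaN2.add {p q : MvPolynomial (Idx n) ℝ} (hp : SigmaN2 p) (hq : SigmaN2 q) :
    SigmaN2 (p + q) := by
  obtain ⟨⟨k, f, hf⟩, hpd⟩ := hp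
  obtain ⟨⟨l, g, hg⟩, hqd⟩ := hq
  refine ⟨⟨k + l, Fin.append f g, ?_⟩,
    (MvPolynomial.totalDegree_add _ _).trans (max_le hpd hqd)⟩
  simp [Fin.sum_univ_add, hf, hg]

lemma SigmaN2.C_mul_sq {c : ℝ} (hc : 0 ≤ c) {q : MvPolynomial (Idx n) ℝ}
    (hq : q.totalDegree ≤ 1) : SigmaN2 (MvPolynomial.C c * q ^ 2) := by
  refine ⟨⟨1, fun _ => MvPolynomial.C (Real.sqrt c) * q, ?_⟩, ?_⟩
  · simp [mul_pow, ← map_pow, Real.sq_sqrt hc]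
  · refine (MvPolynomial.totalDegree_mul _ _).trans ?_
    have := MvPolynomial.totalDegree_pow q 2
    simp only [MvPolynomial.totalDegree_C]
    omega

lemma IsSquare.mul_eq {a b c e : Idx n} (h : IsSquare a b c e) {T : Idx n → ℝ}
    (hT : IsRankOne T) : T a * T b = T c * T e := by
  obtain ⟨u, hu⟩ := hT
  simp only [hu, ← Finset.prod_mul_distrib]
  refine Finset.prod_congr rfl fun k _ => ?_
  have hk : (a k = c k ∧ b k = e k) ∨ (a k = e k ∧ b k = c k) := by
    have := h.2 k
    grind
  rcases hk with ⟨h₁, h₂⟩ | ⟨h₁, h₂⟩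
  · rw [h₁, h₂]
  · rw [h₁, h₂, mul_comm]

lemma ne_zero_of_PSR {Ω : Set (Idx n)} {T : Idx n → ℝ} (hnz : ∀ α ∈ Ω, T α ≠ 0)
    (hT : IsRankOne T) {β : Idx n} (h : PSR Ω β) : T β ≠ 0 := by
  induction h with
  | base h => exact hnz _ h
  | prop hsq h₁ _ _ ih =>
    intro h0
    have := hsq.mul_eq hT
    rw [h0, mul_zero] at this
    exact mul_ne_zero (hnz _ h₁) ih this

/-- The variable `x_α` normalized to take the value one at `T`. -/
noncomputable def normX (T : Idx n → ℝ) (α : Idx n) : MvPolynomial (Idx n) ℝ :=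
  MvPolynomial.C (T α)⁻¹ * MvPolynomial.X α

lemma totalDegree_normX_le (T : Idx n → ℝ) (α : Idx n) : (normX T α).totalDegree ≤ 1 := by
  refine (MvPolynomial.totalDegree_mul _ _).trans ?_
  simp

lemma C_sq_mul_X_sub {T : Idx n → ℝ} {α : Idx n} (hα : T α ≠ 0) (δ : ℝ) :
    MvPolynomial.C (δ ^ 2) * (MvPolynomial.X α ^ 2 - MvPolynomial.C (T α ^ 2)) =
      MvPolynomial.C ((δ * T α) ^ 2) * (normX T α ^ 2 - 1) := by
  have h : (MvPolynomial.C (T α) * MvPolynomial.C (T α)⁻¹ : MvPolynomial (Idx n) ℝ) = 1 := by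
    rw [← map_mul, mul_inv_cancel₀ hα, map_one]
  simp only [normX, map_pow, map_mul]
  linear_combination (-(MvPolynomial.C δ ^ 2 * MvPolynomial.X α ^ 2)) *
    (MvPolynomial.C (T α) * MvPolynomial.C (T α)⁻¹ + 1) * h

lemma C_mul_mem {W : Submodule ℝ (MvPolynomial (Idx n) ℝ)} (c : ℝ)
    {p : MvPolynomial (Idx n) ℝ} (hp : p ∈ W) : MvPolynomial.C c * p ∈ W := by
  rw [← MvPolynomial.smul_eq_C_mul]
  exact W.smul_mem c hp

lemma normX_sub_one_mem {Ω : Set (Idx n)} {T : Idx n → ℝ} {α : Idx n} (hα : α ∈ Ω)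
    (h0 : T α ≠ 0) : normX T α - 1 ∈ I2span Ω T ⊔ J2span n := by
  have h : (MvPolynomial.C (T α)⁻¹ * MvPolynomial.C (T α) : MvPolynomial (Idx n) ℝ) = 1 := by
    rw [← map_mul, inv_mul_cancel₀ h0, map_one]
  have hf : fPoly T α ∈ I2span Ω T ⊔ J2span n :=
    Submodule.mem_sup_left (Submodule.subset_span (Or.inl ⟨α, hα, rfl⟩))
  convert C_mul_mem (T α)⁻¹ hf using 1
  simp only [normX, fPoly]
  linear_combination h

lemma normX_sq_sub_one_mem {Ω : Set (Idx n)} {T : Idx n → ℝ} {α : Idx n} (hα : α ∈ Ω)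
    (h0 : T α ≠ 0) : normX T α ^ 2 - 1 ∈ I2span Ω T ⊔ J2span n := by
  have hg : gPoly T α ∈ I2span Ω T ⊔ J2span n :=
    Submodule.mem_sup_left (Submodule.subset_span (Or.inr ⟨α, hα, rfl⟩))
  convert C_mul_mem ((T α)⁻¹ ^ 2) hg using 1
  rw [gPoly, C_sq_mul_X_sub h0, inv_mul_cancel₀ h0]
  simp

lemma normX_mul_sub_mem {Ω : Set (Idx n)} {T : Idx n → ℝ} (hT : IsRankOne T)
    {a b c e : Idx n} (h : IsSquare a b c e) :
    normX T a * normX T b - normX T c * normX T e ∈ I2span Ω T ⊔ J2span n := by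
  have hJ : (MvPolynomial.X a * MvPolynomial.X b - MvPolynomial.X c * MvPolynomial.X e :
      MvPolynomial (Idx n) ℝ) ∈ I2span Ω T ⊔ J2span n :=
    Submodule.mem_sup_right (Submodule.subset_span ⟨a, b, c, e, h, rfl⟩)
  have hC : (MvPolynomial.C (T a)⁻¹ * MvPolynomial.C (T b)⁻¹ : MvPolynomial (Idx n) ℝ) =
      MvPolynomial.C (T c)⁻¹ * MvPolynomial.C (T e)⁻¹ := by
    rw [← map_mul, ← map_mul, ← mul_inv, ← mul_inv, h.mul_eq hT]
  convert C_mul_mem ((T a)⁻¹ * (T b)⁻¹) hJ using 1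
  simp only [normX, map_mul]
  linear_combination (MvPolynomial.X c * MvPolynomial.X e) * hC

/-- The product of two normalized observed variables, minus one, is congruent to a square. -/
lemma normX_mul_sub_one_mem {Ω : Set (Idx n)} {T : Idx n → ℝ} (hnz : ∀ α ∈ Ω, T α ≠ 0)
    {a b : Idx n} (ha : a ∈ Ω) (hb : b ∈ Ω) :
    2 * (normX T a * normX T b - 1) - (normX T a + normX T b - 2) ^ 2
      ∈ I2span Ω T ⊔ J2span n := by
  have h₁ := normX_sq_sub_one_mem ha (hnz a ha)
  have h₂ := normX_sq_sub_one_mem hb (hnz b hb)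
  have h₃ := C_mul_mem 4 (add_mem (normX_sub_one_mem ha (hnz a ha))
    (normX_sub_one_mem hb (hnz b hb)))
  convert sub_mem h₃ (add_mem h₁ h₂) using 1
  rw [map_ofNat]
  ring

/-- Along a propagation sequence, a cross term with an observed entry can be completed to a
sum of squares by adding nonnegative multiples of the `x_{s i}² - T_{s i}²`. -/
lemma exists_sos_of_propagation_sequence {Ω : Set (Idx n)} {T : Idx n → ℝ}
    (hnz : ∀ α ∈ Ω, T α ≠ 0) (hT : IsRankOne T) (hall : ∀ α, T α ≠ 0) (m : ℕ) :
    ∀ s : ℕ → Idx n, s m ∈ Ω →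
      (∀ i < m, ∃ a ∈ Ω, ∃ b ∈ Ω, IsSquare a (s i) b (s (i + 1))) →
      ∀ b ∈ Ω, ∀ c : ℝ, 0 ≤ c → ∃ δ : ℕ → ℝ, ∃ p : MvPolynomial (Idx n) ℝ, SigmaN2 p ∧
        (∑ i ∈ Finset.range (m + 1), MvPolynomial.C (δ i ^ 2) *
          (MvPolynomial.X (s i) ^ 2 - MvPolynomial.C (T (s i) ^ 2))) +
          MvPolynomial.C c * (2 * (normX T b * normX T (s 0) - 1)) - p
          ∈ I2span Ω T ⊔ J2span n := by
  have hdeg : ∀ a b : Idx n, (normX T a + normX T b - 2).totalDegree ≤ 1 := by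
    intro a b
    refine (MvPolynomial.totalDegree_sub _ _).trans (max_le
      ((MvPolynomial.totalDegree_add _ _).trans
        (max_le (totalDegree_normX_le T a) (totalDegree_normX_le T b))) ?_)
    rw [← map_ofNat MvPolynomial.C 2, MvPolynomial.totalDegree_C]
    exact zero_le_one
  induction m with
  | zero =>
    intro s hs _ b hb c hc
    refine ⟨0, MvPolynomial.C c * (normX T b + normX T (s 0) - 2) ^ 2,
      SigmaN2.C_mul_sq hc (hdeg _ _), ?_⟩
    convert C_mul_mem c (normX_mul_sub_one_mem hnz hb hs) using 1
    simp
    ring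
  | succ m ih =>
    intro s hs hstep b hb c hc
    obtain ⟨a, ha, b', hb', hsq⟩ := hstep 0 (Nat.succ_pos m)
    obtain ⟨δ, p, hp, hmem⟩ := ih (fun i => s (i + 1)) hs
      (fun i hi => hstep (i + 1) (Nat.succ_lt_succ hi)) b' hb' (2 * c) (by positivity)
    have hlin : (normX T (s 0) + normX T b - MvPolynomial.C 2 * normX T a).totalDegree ≤ 1 := by
      refine (MvPolynomial.totalDegree_sub _ _).trans (max_le
        ((MvPolynomial.totalDegree_add _ _).trans
          (max_le (totalDegree_normX_le T _) (totalDegree_normX_le T b))) ?_)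
      refine (MvPolynomial.totalDegree_mul _ _).trans ?_
      simpa using totalDegree_normX_le T a
    refine ⟨fun i => Nat.casesOn i (Real.sqrt c / T (s 0)) δ,
      p + (MvPolynomial.C c * (normX T (s 0) + normX T b - MvPolynomial.C 2 * normX T a) ^ 2
        + MvPolynomial.C (2 * c) * (normX T b + normX T a - 2) ^ 2),
      hp.add ((SigmaN2.C_mul_sq hc hlin).add
        (SigmaN2.C_mul_sq (by positivity) (hdeg _ _))), ?_⟩
    have h₁ := C_mul_mem (4 * c) (normX_mul_sub_mem (Ω := Ω) hT hsq)
    have h₂ := C_mul_mem (2 * c) (normX_mul_sub_one_mem hnz hb ha)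
    have h₃ := C_mul_mem c (add_mem (normX_sq_sub_one_mem hb (hnz b hb))
      (C_mul_mem 4 (normX_sq_sub_one_mem ha (hnz a ha))))
    convert add_mem hmem (sub_mem (add_mem h₁ h₂) h₃) using 1
    rw [Finset.sum_range_succ']
    simp only [Nat.rec_zero]
    rw [C_sq_mul_X_sub (hall (s 0)), div_mul_cancel₀ _ (hall (s 0)), Real.sq_sqrt hc]
    simp only [map_mul, map_ofNat, zero_add]
    ring

end

/-- Along an SR-propagation sequence `s(β) = (β⁽⁰⁾,…,β⁽ᵐ⁾)` of an
unobserved `β`, there are constants `δ_{β⁽ⁱ⁾}` with `δ_{β⁽⁰⁾} ≠ 0` and `p̃_β ∈ Σ_{N,2}`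
such that `Σᵢ δᵢ² (x_{β⁽ⁱ⁾}² - T_{β⁽ⁱ⁾}²) = δ₀² (x_β - (T_β/T_{α₀}) x_{α₀})² + p̃_β`
mod `(I₂ + J₂)`. -/
theorem statement19 {d : ℕ} {n : Fin d → ℕ} (Ω : Set (Idx n))
    (T : Idx n → ℝ) (hSR : SRPropagation Ω) (hnz : ∀ α ∈ Ω, T α ≠ 0)
    (hT : IsRankOne T)
    (huniq : ∀ T' : Idx n → ℝ, IsRankOne T' → (∀ α ∈ Ω, T' α = T α) → T' = T)
    (β : Idx n) (hβ : β ∉ Ω)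
    (m : ℕ) (s : ℕ → Idx n)
    (hs0 : s 0 = β) (hsm : s m ∈ Ω)
    (hstep : ∀ i < m, ∃ a ∈ Ω, ∃ at1 ∈ Ω, IsSquare a (s i) at1 (s (i + 1)))
    (α₀ : Idx n) (hα₀ : α₀ ∈ Ω)
    (hfirst : ∃ at1 ∈ Ω, IsSquare α₀ (s 0) at1 (s 1)) :
    ∃ δ : ℕ → ℝ, δ 0 ≠ 0 ∧ ∃ ptil : MvPolynomial (Idx n) ℝ, SigmaN2 ptil ∧
      ((∑ i ∈ Finset.range (m + 1), MvPolynomial.C (δ i ^ 2) *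
          (MvPolynomial.X (s i) ^ 2 - MvPolynomial.C (T (s i) ^ 2))) -
        (MvPolynomial.C (δ 0 ^ 2) *
            (MvPolynomial.X β - MvPolynomial.C (T β / T α₀) * MvPolynomial.X α₀) ^ 2
          + ptil)
        ∈ I2span Ω T ⊔ J2span n) := by
  have hall : ∀ α, T α ≠ 0 := fun α => ne_zero_of_PSR hnz hT (hSR α)
  subst hs0
  obtain ⟨b, hb, hsq⟩ := hfirst
  obtain _ | m := m
  · exact absurd hsm hβ
  obtain ⟨δ, p, hp, hmem⟩ := exists_sos_of_propagation_sequence hnz hT hall m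
    (fun i => s (i + 1)) hsm (fun i hi => hstep (i + 1) (Nat.succ_lt_succ hi)) b hb 1 zero_le_one
  refine ⟨fun i => Nat.casesOn i (T (s 0))⁻¹ δ, inv_ne_zero (hall _), p, hp, ?_⟩
  have h₁ := C_mul_mem 2 (normX_mul_sub_mem (Ω := Ω) hT hsq)
  have h₂ := normX_sq_sub_one_mem hα₀ (hnz _ hα₀)
  have hC : (MvPolynomial.C (T (s 0))⁻¹ * MvPolynomial.C (T (s 0)) :
      MvPolynomial (Idx n) ℝ) = 1 := by
    rw [← map_mul, inv_mul_cancel₀ (hall _), map_one]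
  have hlead : MvPolynomial.C ((T (s 0))⁻¹ ^ 2) * (MvPolynomial.X (s 0) -
      MvPolynomial.C (T (s 0) / T α₀) * MvPolynomial.X α₀) ^ 2 =
      (normX T (s 0) - normX T α₀) ^ 2 := by
    rw [map_pow, ← mul_pow]
    congr 1
    simp only [normX, div_eq_mul_inv, map_mul]
    linear_combination (-(MvPolynomial.C (T α₀)⁻¹ * MvPolynomial.X α₀)) * hC
  convert add_mem hmem (sub_mem h₁ h₂) using 1
  rw [Finset.sum_range_succ']
  simp only [Nat.rec_zero]
  rw [hlead, C_sq_mul_X_sub (hall (s 0)), inv_mul_cancel₀ (hall (s 0))]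
  simp only [map_ofNat, map_one, one_pow, zero_add]
  ring


end RankOneTC
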